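/- For every α ∈ (0,1), every β ≥ 0, and finite alphabets, the maximum of β I(Y;W) − H_α(W) over all conditional distributions P_{W|X} (with Y–X–W a Markov chain and |𝒲| = M finite) is attained by a deterministic conditional distribution, i.e., one where P_{W|X}(w|x) ∈ {0,1} for all x ∈ 𝒳 and w ∈ 𝒲. -/

import Mathlib

open Real BigOperators Filter

noncomputable section

/-- Base-2 Shannon entropy of a probability vector on a finite alphabet. -/
def shEnt {I : Type} [Fintype I] (P : I → ℝ) : ℝ := -∑ i, P i * Real.logb 2 (P i)

/-- Rényi entropy of order `α` (base 2) of a probability vector. -/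
def renyiEnt {I : Type} [Fintype I] (α : ℝ) (P : I → ℝ) : ℝ :=
  (1 - α)⁻¹ * Real.logb 2 (∑ i, P i ^ α)

open Classical in
/-- Entropy of order `α`, where `α = 1` is understood as Shannon entropy. -/
def entOrd {I : Type} [Fintype I] (α : ℝ) (P : I → ℝ) : ℝ :=
  if α = 1 then shEnt P else renyiEnt α P

/-- `p` is a joint pmf on `Y × X`. -/
def IsJointPmf {Y X : Type} [Fintype Y] [Fintype X] (p : Y → X → ℝ) : Prop :=
  (∀ y x, 0 ≤ p y x) ∧ ∑ y, ∑ x, p y x = 1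

/-- `q` is a channel (conditional pmf) from `X` to `W`. -/
def IsKernel {X W : Type} [Fintype X] [Fintype W] (q : X → W → ℝ) : Prop :=
  (∀ x w, 0 ≤ q x w) ∧ ∀ x, ∑ w, q x w = 1

def margX {Y X : Type} [Fintype Y] [Fintype X] (p : Y → X → ℝ) (x : X) : ℝ := ∑ y, p y x

def margY {Y X : Type} [Fintype Y] [Fintype X] (p : Y → X → ℝ) (y : Y) : ℝ := ∑ x, p y x

/-- Marginal of `W` when `W` is generated from `X` through the channel `q`. -/
def margW {Y X W : Type} [Fintype Y] [Fintype X] [Fintype W]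
    (p : Y → X → ℝ) (q : X → W → ℝ) (w : W) : ℝ := ∑ x, margX p x * q x w

/-- Joint pmf of `(Y, W)` under the Markov chain `Y - X - W`. -/
def jointYW {Y X W : Type} [Fintype Y] [Fintype X] [Fintype W]
    (p : Y → X → ℝ) (q : X → W → ℝ) (y : Y) (w : W) : ℝ := ∑ x, p y x * q x w

/-- Joint pmf of `(X, W)`. -/
def jointXW {Y X W : Type} [Fintype Y] [Fintype X] [Fintype W]
    (p : Y → X → ℝ) (q : X → W → ℝ) (x : X) (w : W) : ℝ := margX p x * q x w

/-- Mutual information (base 2) of a joint pmf on `A × B`. -/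
def mi2 {A B : Type} [Fintype A] [Fintype B] (r : A → B → ℝ) : ℝ :=
  shEnt (fun a => ∑ b, r a b) + shEnt (fun b => ∑ a, r a b)
    - shEnt (fun ab : A × B => r ab.1 ab.2)

/-- `I(Y;W)` under the Markov chain `Y - X - W`. -/
def miYW {Y X W : Type} [Fintype Y] [Fintype X] [Fintype W]
    (p : Y → X → ℝ) (q : X → W → ℝ) : ℝ := mi2 (jointYW p q)

/-- `I(Y;X)`. -/
def miYX {Y X : Type} [Fintype Y] [Fintype X] (p : Y → X → ℝ) : ℝ := mi2 p

/-- `I(X;W)`. -/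
def miXW {Y X W : Type} [Fintype Y] [Fintype X] [Fintype W]
    (p : Y → X → ℝ) (q : X → W → ℝ) : ℝ := mi2 (jointXW p q)

/-- The bottleneck function `F_{α,M}(γ)`: maximal relevance `I(Y;W)` over channels
`P_{W|X}` with output alphabet of size (at most) `M` satisfying `H_α(W) ≤ γ`. -/
def Ffun {Y X : Type} [Fintype Y] [Fintype X] (p : Y → X → ℝ) (M : ℕ) (α γ : ℝ) : ℝ :=
  sSup {v | ∃ q : X → Fin M → ℝ, IsKernel q ∧ entOrd α (margW p q) ≤ γ ∧ v = miYW p q}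

/-- Upper concave envelope on `[0,∞)` via two-point convex combinations. -/
def env (F : ℝ → ℝ) (γ : ℝ) : ℝ :=
  sSup {v | ∃ t γ₁ γ₂ : ℝ, 0 ≤ t ∧ t ≤ 1 ∧ 0 ≤ γ₁ ∧ 0 ≤ γ₂ ∧
    t * γ₁ + (1 - t) * γ₂ = γ ∧ v = t * F γ₁ + (1 - t) * F γ₂}

/-- The information bottleneck function `\bar I_IB(r)`. -/
def IBfun {Y X : Type} [Fintype Y] [Fintype X] (p : Y → X → ℝ) (r : ℝ) : ℝ :=
  sSup {v | ∃ (m : ℕ) (q : X → Fin m → ℝ), IsKernel q ∧ miXW p q ≤ r ∧ v = miYW p q}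

/-- The i.i.d. joint pmf of `(Yⁿ, Xⁿ)`. -/
def iidP {Y X : Type} [Fintype Y] [Fintype X] (p : Y → X → ℝ) (n : ℕ)
    (yn : Fin n → Y) (xn : Fin n → X) : ℝ := ∏ i, p (yn i) (xn i)

open Classical in
/-- Joint pmf of `(Y_i, W_i)` when `Wⁿ` is produced from `Xⁿ` by the (possibly randomized)
code `Q` and `(Yⁿ, Xⁿ)` is i.i.d. with per-letter law `p`. -/
def pairYW {Y X W : Type} [Fintype Y] [Fintype X] [Fintype W]
    (p : Y → X → ℝ) (n : ℕ) (Q : (Fin n → X) → (Fin n → W) → ℝ) (i : Fin n)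
    (y : Y) (w : W) : ℝ :=
  ∑ yn : Fin n → Y, ∑ xn : Fin n → X, ∑ wn : Fin n → W,
    iidP p n yn xn * Q xn wn * (if yn i = y ∧ wn i = w then 1 else 0)

/-- Average per-letter output Rényi entropy `γ_n = (1/n) ∑ H_α(W_i)` of a code. -/
def avgRenyi {Y X W : Type} [Fintype Y] [Fintype X] [Fintype W]
    (p : Y → X → ℝ) (n : ℕ) (Q : (Fin n → X) → (Fin n → W) → ℝ) (α : ℝ) : ℝ :=
  (1 / (n : ℝ)) * ∑ i : Fin n, renyiEnt α (fun w => ∑ y, pairYW p n Q i y w)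

/-- Average per-letter relevance `η_n = (1/n) ∑ I(Y_i; W_i)` of a code. -/
def avgRel {Y X W : Type} [Fintype Y] [Fintype X] [Fintype W]
    (p : Y → X → ℝ) (n : ℕ) (Q : (Fin n → X) → (Fin n → W) → ℝ) : ℝ :=
  (1 / (n : ℝ)) * ∑ i : Fin n, mi2 (pairYW p n Q i)

/-- A Rényi entropy-relevance pair `(γ, η)` is achievable if some sequence of
(possibly randomized) codes `Φⁿ : 𝒳ⁿ → 𝒲ⁿ`, `|𝒲| ≤ M`, has
`limsup γ_n ≤ γ` and `liminf η_n ≥ η`. -/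
def Achievable {Y X : Type} [Fintype Y] [Fintype X]
    (p : Y → X → ℝ) (M : ℕ) (α γ η : ℝ) : Prop :=
  ∃ Q : (n : ℕ) → (Fin n → X) → (Fin n → Fin M) → ℝ,
    (∀ n, IsKernel (Q n)) ∧
    Filter.limsup (fun n => avgRenyi p n (Q n) α) Filter.atTop ≤ γ ∧
    η ≤ Filter.liminf (fun n => avgRel p n (Q n)) Filter.atTop

/-- The achievable Rényi entropy-relevance region: the closure of all achievable pairs. -/
def Region {Y X : Type} [Fintype Y] [Fintype X]
    (p : Y → X → ℝ) (M : ℕ) (α : ℝ) : Set (ℝ × ℝ) :=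
  closure {z : ℝ × ℝ | 0 ≤ z.1 ∧ 0 ≤ z.2 ∧ Achievable p M α z.1 z.2}

/-- `I_{α,M}(γ)`: the maximal achievable relevance at Rényi entropy cost `γ`. -/
def Irel {Y X : Type} [Fintype Y] [Fintype X]
    (p : Y → X → ℝ) (M : ℕ) (α γ : ℝ) : ℝ :=
  sSup {η | (γ, η) ∈ Region p M α}


/-- The summand `u * log (u / v)` of the relative entropy is jointly convex. -/
theorem convexOn_mul_logb_sub :
    ConvexOn ℝ {z : ℝ × ℝ | 0 ≤ z.1 ∧ z.1 ≤ z.2}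
      (fun z => z.1 * Real.logb 2 z.1 - z.1 * Real.logb 2 z.2) := by
  have tangent (c u v : ℝ) (hc : 0 < c) (hu : 0 ≤ u) (huv : u ≤ v) :
      u * Real.log c + (u - c * v) ≤ u * Real.log u - u * Real.log v := by
    rcases hu.eq_or_lt with rfl | hu
    · simpa using mul_nonneg hc.le huv
    · have hv : 0 < v := hu.trans_le huv
      have h := Real.log_le_sub_one_of_pos (show 0 < c * v / u by positivity)
      rw [Real.log_div (by positivity) hu.ne', Real.log_mul hc.ne' hv.ne'] at h
      have h' := mul_le_mul_of_nonneg_left h hu.le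
      have e : u * (c * v / u - 1) = c * v - u := by field_simp
      rw [e] at h'
      linarith
  have key : ConvexOn ℝ {z : ℝ × ℝ | 0 ≤ z.1 ∧ z.1 ≤ z.2}
      (fun z => z.1 * Real.log z.1 - z.1 * Real.log z.2) := by
    have hconv : Convex ℝ {z : ℝ × ℝ | 0 ≤ z.1 ∧ z.1 ≤ z.2} := by
      rintro ⟨u, v⟩ ⟨hu, huv⟩ ⟨u', v'⟩ ⟨hu', huv'⟩ a b ha hb -
      simp only [Set.mem_ofPred_eq, Prod.smul_mk, Prod.mk_add_mk, smul_eq_mul] at *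
      exact ⟨by positivity, by gcongr⟩
    refine ⟨hconv, ?_⟩
    rintro ⟨u, v⟩ h₁ ⟨u', v'⟩ h₂ a b ha hb hab
    have h₃ := hconv h₁ h₂ ha hb hab
    simp only [Set.mem_ofPred_eq, Prod.smul_mk, Prod.mk_add_mk, smul_eq_mul] at *
    set U := a * u + b * u'
    set V := a * v + b * v' with hV
    rcases h₃.1.eq_or_lt with hU | hU
    · have e₁ : 0 = a * u ∧ 0 = b * u' := by
        have := mul_nonneg ha h₁.1
        have := mul_nonneg hb h₂.1
        constructor <;> linarith
      rw [← hU, mul_sub, mul_sub, ← mul_assoc, ← mul_assoc, ← mul_assoc, ← mul_assoc,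
        ← e₁.1, ← e₁.2]
      simp
    · have hVpos : 0 < V := hU.trans_le h₃.2
      have hc : 0 < U / V := div_pos hU hVpos
      have i₁ := mul_le_mul_of_nonneg_left (tangent (U / V) u v hc h₁.1 h₁.2) ha
      have i₂ := mul_le_mul_of_nonneg_left (tangent (U / V) u' v' hc h₂.1 h₂.2) hb
      have e : U / V * V = U := by field_simp
      calc U * Real.log U - U * Real.log V
          = U * Real.log (U / V) + (U - U / V * V) := by
            rw [Real.log_div hU.ne' hVpos.ne', e]; ring
        _ = a * (u * Real.log (U / V) + (u - U / V * v))
            + b * (u' * Real.log (U / V) + (u' - U / V * v')) := by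
            simp only [U, hV]; ring
        _ ≤ _ := add_le_add i₁ i₂
  have h2 : 0 ≤ (Real.log 2)⁻¹ := by positivity
  refine (key.smul h2).congr fun z _ => ?_
  simp only [Real.logb, smul_eq_mul]
  ring

theorem sum_rpow_pos {I : Type} [Fintype I] {α : ℝ} {P : I → ℝ} (hP : P ∈ stdSimplex ℝ I) :
    0 < ∑ i, P i ^ α := by
  have hpos : 0 < ∑ i, P i := hP.2 ▸ one_pos
  obtain ⟨i, -, hi⟩ := (Finset.sum_pos_iff_of_nonneg fun i _ => hP.1 i).1 hpos
  exact Finset.sum_pos' (fun j _ => Real.rpow_nonneg (hP.1 j) α)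
    ⟨i, Finset.mem_univ i, Real.rpow_pos_of_pos hi α⟩

theorem concaveOn_renyiEnt {I : Type} [Fintype I] {α : ℝ} (hα0 : 0 ≤ α) (hα1 : α < 1) :
    ConcaveOn ℝ (stdSimplex ℝ I) (renyiEnt α) := by
  refine ⟨convex_stdSimplex ℝ I, fun P hP Q hQ a b ha hb hab => ?_⟩
  have hR := convex_stdSimplex ℝ I hP hQ ha hb hab
  have hsum : a * ∑ i, P i ^ α + b * ∑ i, Q i ^ α ≤ ∑ i, (a • P + b • Q) i ^ α := by
    rw [Finset.mul_sum, Finset.mul_sum, ← Finset.sum_add_distrib]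
    exact Finset.sum_le_sum fun i _ =>
      (Real.concaveOn_rpow hα0 hα1.le).2 (hP.1 i) (hQ.1 i) ha hb hab
  have hmix : 0 < a * ∑ i, P i ^ α + b * ∑ i, Q i ^ α :=
    (convex_Ioi (0 : ℝ)) (sum_rpow_pos hP) (sum_rpow_pos hQ) ha hb hab
  have hlog := (strictConcaveOn_log_Ioi.concaveOn.2 (sum_rpow_pos (α := α) hP)
    (sum_rpow_pos (α := α) hQ) ha hb hab).trans (Real.log_le_log hmix hsum)
  have hc : 0 ≤ (1 - α)⁻¹ * (Real.log 2)⁻¹ := by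
    have : 0 < 1 - α := by linarith
    positivity
  have h := mul_le_mul_of_nonneg_left hlog hc
  simp only [renyiEnt, Real.logb, smul_eq_mul] at h ⊢
  convert h using 1 <;> ring

/-- Kernels form the product of standard simplices, the convex hull of the deterministic ones. -/
theorem convexHull_deterministic_kernels {X W : Type} [Fintype X] [Fintype W] [DecidableEq W] :
    convexHull ℝ (Set.range fun (f : X → W) (x : X) (w : W) => if f x = w then (1 : ℝ) else 0)
      = {q : X → W → ℝ | IsKernel q} := by
  have h : (Set.range fun (f : X → W) (x : X) (w : W) => if f x = w then (1 : ℝ) else 0)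
      = Set.univ.pi fun _ : X => Set.range fun (i j : W) => if i = j then (1 : ℝ) else 0 := by
    ext q
    constructor
    · rintro ⟨f, rfl⟩ x -
      exact ⟨f x, rfl⟩
    · intro hq
      choose f hf using fun x => hq x (Set.mem_univ x)
      exact ⟨f, funext hf⟩
  rw [h, convexHull_pi]
  ext q
  simp only [convexHull_basis_eq_stdSimplex, Set.mem_univ_pi, Set.mem_ofPred_eq, IsKernel,
    stdSimplex]
  exact forall_and

section Channel

variable {Y X W : Type} [Fintype Y] [Fintype X] [Fintype W] {p : Y → X → ℝ}

theorem convex_setOf_isKernel : Convex ℝ {q : X → W → ℝ | IsKernel q} := by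
  classical
  rw [← convexHull_deterministic_kernels]
  exact convex_convexHull ℝ _

theorem jointYW_combo (q q' : X → W → ℝ) (a b : ℝ) (y : Y) (w : W) :
    jointYW p (a • q + b • q') y w = a * jointYW p q y w + b * jointYW p q' y w := by
  simp only [jointYW, Finset.mul_sum, ← Finset.sum_add_distrib]
  refine Finset.sum_congr rfl fun x _ => ?_
  simp only [Pi.add_apply, Pi.smul_apply, smul_eq_mul]
  ring

theorem sum_jointYW (q : X → W → ℝ) (w : W) : ∑ y, jointYW p q y w = margW p q w := by
  simp only [jointYW, margW, margX, Finset.sum_mul]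
  exact Finset.sum_comm

theorem sum_jointYW_of_isKernel {q : X → W → ℝ} (hq : IsKernel q) (y : Y) :
    ∑ w, jointYW p q y w = margY p y := by
  simp only [jointYW, margY]
  rw [Finset.sum_comm]
  exact Finset.sum_congr rfl fun x _ => by rw [← Finset.mul_sum, hq.2 x, mul_one]

theorem margW_combo (q q' : X → W → ℝ) (a b : ℝ) :
    margW p (a • q + b • q') = a • margW p q + b • margW p q' := by
  ext w
  simp only [Pi.add_apply, Pi.smul_apply, smul_eq_mul, ← sum_jointYW, jointYW_combo,
    Finset.mul_sum, Finset.sum_add_distrib]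

theorem jointYW_nonneg (hp : IsJointPmf p) {q : X → W → ℝ} (hq : IsKernel q) (y : Y) (w : W) :
    0 ≤ jointYW p q y w :=
  Finset.sum_nonneg fun x _ => mul_nonneg (hp.1 y x) (hq.1 x w)

theorem jointYW_le_margW (hp : IsJointPmf p) {q : X → W → ℝ} (hq : IsKernel q) (y : Y) (w : W) :
    jointYW p q y w ≤ margW p q w := by
  rw [← sum_jointYW]
  exact Finset.single_le_sum (f := fun y => jointYW p q y w)
    (fun y _ => jointYW_nonneg hp hq y w) (Finset.mem_univ y)

theorem margW_mem_stdSimplex (hp : IsJointPmf p) {q : X → W → ℝ} (hq : IsKernel q) :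
    margW p q ∈ stdSimplex ℝ W := by
  constructor
  · intro w
    rw [← sum_jointYW]
    exact Finset.sum_nonneg fun y _ => jointYW_nonneg hp hq y w
  · simp only [← sum_jointYW]
    rw [Finset.sum_comm]
    simp only [sum_jointYW_of_isKernel hq]
    exact hp.2

theorem miYW_eq {q : X → W → ℝ} (hq : IsKernel q) :
    miYW p q = shEnt (margY p) + ∑ y, ∑ w,
      (jointYW p q y w * Real.logb 2 (jointYW p q y w)
        - jointYW p q y w * Real.logb 2 (margW p q w)) := by
  have h : ∑ y, ∑ w, jointYW p q y w * Real.logb 2 (margW p q w)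
      = ∑ w, margW p q w * Real.logb 2 (margW p q w) := by
    rw [Finset.sum_comm]
    simp only [← Finset.sum_mul, sum_jointYW]
  simp only [miYW, mi2, sum_jointYW, sum_jointYW_of_isKernel hq, Finset.sum_sub_distrib, h]
  simp only [shEnt, Fintype.sum_prod_type]
  ring

theorem convexOn_miYW (hp : IsJointPmf p) :
    ConvexOn ℝ {q : X → W → ℝ | IsKernel q} (miYW p) := by
  refine ⟨convex_setOf_isKernel, fun q hq q' hq' a b ha hb hab => ?_⟩
  have hterm (y : Y) (w : W) := convexOn_mul_logb_sub.2
    (x := (jointYW p q y w, margW p q w)) ⟨jointYW_nonneg hp hq y w, jointYW_le_margW hp hq y w⟩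
    (y := (jointYW p q' y w, margW p q' w))
    ⟨jointYW_nonneg hp hq' y w, jointYW_le_margW hp hq' y w⟩ ha hb hab
  have hsum := Finset.sum_le_sum fun y (_ : y ∈ Finset.univ) =>
    Finset.sum_le_sum fun w (_ : w ∈ Finset.univ) => hterm y w
  rw [miYW_eq (convex_setOf_isKernel hq hq' ha hb hab), miYW_eq hq, miYW_eq hq']
  simp only [Prod.smul_mk, Prod.mk_add_mk, smul_eq_mul, Finset.sum_add_distrib,
    ← Finset.mul_sum] at hsum
  simp only [jointYW_combo, margW_combo, Pi.add_apply, Pi.smul_apply, smul_eq_mul]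
  have hconst : shEnt (margY p) = a * shEnt (margY p) + b * shEnt (margY p) := by
    rw [← add_mul, hab, one_mul]
  linarith

theorem concaveOn_renyiEnt_margW (hp : IsJointPmf p) {α : ℝ} (hα0 : 0 ≤ α) (hα1 : α < 1) :
    ConcaveOn ℝ {q : X → W → ℝ | IsKernel q} fun q => renyiEnt α (margW p q) := by
  refine ⟨convex_setOf_isKernel, fun q hq q' hq' a b ha hb hab => ?_⟩
  simp only [margW_combo]
  exact (concaveOn_renyiEnt hα0 hα1).2 (margW_mem_stdSimplex hp hq)
    (margW_mem_stdSimplex hp hq') ha hb hab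

end Channel

/-- for every `α ∈ (0,1)` and `β ≥ 0`, the maximum of `β I(Y;W) − H_α(W)`
over channels `P_{W|X}` with `|𝒲| = M` is attained by a deterministic channel. -/
theorem stmt9 {Y X : Type} [Fintype Y] [Fintype X]
    (p : Y → X → ℝ) (hp : IsJointPmf p)
    (M : ℕ) (hM : 0 < M) (α : ℝ) (hα0 : 0 < α) (hα1 : α < 1)
    (β : ℝ) (hβ : 0 ≤ β) :
    ∃ q : X → Fin M → ℝ, IsKernel q ∧ (∀ x w, q x w = 0 ∨ q x w = 1) ∧
      ∀ q' : X → Fin M → ℝ, IsKernel q' →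
        β * miYW p q' - renyiEnt α (margW p q')
          ≤ β * miYW p q - renyiEnt α (margW p q) := by
  have : Nonempty (Fin M) := ⟨⟨0, hM⟩⟩
  let obj : (X → Fin M → ℝ) → ℝ := fun q => β * miYW p q - renyiEnt α (margW p q)
  let det : (X → Fin M) → X → Fin M → ℝ := fun f x w => if f x = w then 1 else 0
  have hull : convexHull ℝ (Set.range det) = {q | IsKernel q} :=
    convexHull_deterministic_kernels
  have hobj : ConvexOn ℝ (convexHull ℝ (Set.range det)) obj := by
    rw [hull]
    exact ((convexOn_miYW hp).smul hβ).sub (concaveOn_renyiEnt_margW hp hα0.le hα1)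
  obtain ⟨f, hf⟩ := Finite.exists_max fun f => obj (det f)
  have hdet : det f ∈ {q | IsKernel q} :=
    hull ▸ subset_convexHull ℝ _ (Set.mem_range_self f)
  refine ⟨det f, hdet, fun x w => (ite_eq_or_eq (f x = w) (1 : ℝ) 0).symm, fun q' hq' => ?_⟩
  have hq'_mem : q' ∈ convexHull ℝ (Set.range det) := hull.symm ▸ hq'
  obtain ⟨_, ⟨g, rfl⟩, hg⟩ := hobj.exists_ge_of_mem_convexHull (subset_convexHull ℝ _) hq'_mem
  exact hg.trans (hf g)

end
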